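/- For any two projection games G and H, the relaxed value is perfectly multiplicative: val₊*(G⊗H) = val₊*(G)·val₊*(H). -/

import Mathlib

noncomputable section
open scoped Kronecker ComplexOrder
open Matrix

/-- `d × d` complex matrices. -/
abbrev Mat (d : ℕ) := Matrix (Fin d) (Fin d) ℂ

/-- Entrywise complex conjugation of a matrix. -/
def mconj {m n : Type*} (M : Matrix m n ℂ) : Matrix m n ℂ := M.map (starRingEnd ℂ)

/-- Operator (spectral) norm of a square complex matrix. -/
noncomputable def opNorm {n : Type*} [Fintype n] [DecidableEq n] (M : Matrix n n ℂ) : ℝ :=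
  ‖Matrix.toEuclideanCLM (𝕜 := ℂ) M‖

/-- `⟨ψ| M |ψ⟩`. -/
def braket {ι : Type*} [Fintype ι] (ψ : ι → ℂ) (M : Matrix ι ι ℂ) : ℂ :=
  star ψ ⬝ᵥ M.mulVec ψ

/-- Squared Euclidean norm of a complex vector. -/
def enormSq {ι : Type*} [Fintype ι] (ψ : ι → ℂ) : ℝ := ∑ i, Complex.normSq (ψ i)

/-- A family of psd matrices summing to the identity. -/
def IsPOVM {d : ℕ} {α : Type*} [Fintype α] (M : α → Mat d) : Prop :=
  (∀ a, (M a).PosSemidef) ∧ (∑ a, M a) = 1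

/-- A two-player one-round projection game. -/
structure ProjGame where
  U : Type
  V : Type
  A : Type
  B : Type
  [fU : Fintype U]
  [fV : Fintype V]
  [fA : Fintype A]
  [fB : Fintype B]
  [dA : DecidableEq A]
  μ : U → V → ℝ
  μ_nonneg : ∀ u v, 0 ≤ μ u v
  μ_sum : ∑ u, ∑ v, μ u v = 1
  proj : U → V → B → Option A

attribute [instance] ProjGame.fU ProjGame.fV ProjGame.fA ProjGame.fB ProjGame.dA

namespace ProjGame

variable (G : ProjGame)

/-- Marginal distribution on first-player questions. -/
def μL (u : G.U) : ℝ := ∑ v, G.μ u v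

/-- Marginal distribution on second-player questions. -/
def μR (v : G.V) : ℝ := ∑ u, G.μ u v

/-- Conditional distribution `μ(v|u)`. -/
def μc (u : G.U) (v : G.V) : ℝ := G.μ u v / G.μL u

/-- A `d`-dimensional quantum strategy for the first player. -/
def IsStrategyA {d : ℕ} (A : G.U → G.A → Mat d) : Prop := ∀ u, IsPOVM (A u)

/-- A `d`-dimensional quantum strategy for the second player. -/
def IsStrategyB {d : ℕ} (B : G.V → G.B → Mat d) : Prop := ∀ v, IsPOVM (B v)

/-- Success probability of a pair of quantum strategies with shared state `ψ`. -/
def pay {d : ℕ} (A : G.U → G.A → Mat d) (B : G.V → G.B → Mat d)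
    (ψ : Fin d × Fin d → ℂ) : ℝ :=
  ∑ u, ∑ v, G.μ u v * ∑ a, ∑ b,
    if G.proj u v b = some a then (braket ψ (mconj (A u a) ⊗ₖ B v b)).re else 0

/-- The entangled value `val*(G)`. -/
noncomputable def entVal : ℝ :=
  sSup { x | ∃ (d : ℕ) (A : G.U → G.A → Mat d) (B : G.V → G.B → Mat d)
    (ψ : Fin d × Fin d → ℂ),
    G.IsStrategyA A ∧ G.IsStrategyB B ∧ enormSq ψ = 1 ∧ x = G.pay A B ψ }

/-- The operator `B_u^a = Σ_v μ(v|u) Σ_{b → a} B_v^b`. -/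
def Bop {d : ℕ} (B : G.V → G.B → Mat d) (u : G.U) (a : G.A) : Mat d :=
  ∑ v, ∑ b, if G.proj u v b = some a then (G.μc u v : ℂ) • B v b else 0

/-- The matrix `Σ_u μ(u) Σ_a conj(B_u^a) ⊗ B_u^a`. -/
def sqMat {d : ℕ} (B : G.V → G.B → Mat d) :
    Matrix (Fin d × Fin d) (Fin d × Fin d) ℂ :=
  ∑ u, (G.μL u : ℂ) • ∑ a, mconj (G.Bop B u a) ⊗ₖ G.Bop B u a

/-- The square norm `‖G‖*`. -/
noncomputable def sqNorm : ℝ :=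
  sSup { x | ∃ (d : ℕ) (B : G.V → G.B → Mat d), G.IsStrategyB B ∧
    x = Real.sqrt (opNorm (G.sqMat B)) }

/-- A vector quantum strategy over the finite measured space `Fin n`. -/
def IsVecStrategy {n d : ℕ} (A : Fin n → G.V → G.B → Mat d) : Prop :=
  ∀ i v, (∀ b, (A i v b).PosSemidef) ∧ ((1 : Mat d) - ∑ b, A i v b).PosSemidef

/-- The matrix `E_ω conj(A_{ωv}) ⊗ A_{ωv}` at a fixed `v`. -/
def vecMatAt {n d : ℕ} (w : Fin n → ℝ) (A : Fin n → G.V → G.B → Mat d) (v : G.V) :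
    Matrix (Fin d × Fin d) (Fin d × Fin d) ℂ :=
  ∑ i, (w i : ℂ) • (mconj (∑ b, A i v b) ⊗ₖ (∑ b, A i v b))

/-- The matrix appearing in the definition of `val₊*`. -/
def vecMat {n d : ℕ} (w : Fin n → ℝ) (A : Fin n → G.V → G.B → Mat d) :
    Matrix (Fin d × Fin d) (Fin d × Fin d) ℂ :=
  ∑ i, (w i : ℂ) • ∑ u, (G.μL u : ℂ) • ∑ a, ∑ v, ∑ v',
    ((G.μc u v * G.μc u v' : ℝ) : ℂ) • ∑ b, ∑ b',
      if G.proj u v b = some a ∧ G.proj u v' b' = some a then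
        mconj (A i v b) ⊗ₖ A i v' b' else 0

/-- The relaxed value `val₊*(G)`. -/
noncomputable def valPlus : ℝ :=
  sSup { x | ∃ (n d : ℕ) (w : Fin n → ℝ) (A : Fin n → G.V → G.B → Mat d),
    (∀ i, 0 < w i) ∧ G.IsVecStrategy A ∧
    (∀ v, Real.sqrt (opNorm (G.vecMatAt w A v)) ≤ 1) ∧
    x = opNorm (G.vecMat w A) }

/-- The product of two projection games. -/
def prod (H : ProjGame) : ProjGame where
  U := G.U × H.U
  V := G.V × H.V
  A := G.A × H.A
  B := G.B × H.B
  fU := inferInstance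
  fV := inferInstance
  fA := inferInstance
  fB := inferInstance
  dA := inferInstance
  μ := fun p q => G.μ p.1 q.1 * H.μ p.2 q.2
  μ_nonneg := fun p q => mul_nonneg (G.μ_nonneg _ _) (H.μ_nonneg _ _)
  μ_sum := by
    have h1 := G.μ_sum
    have h2 := H.μ_sum
    calc ∑ p : G.U × H.U, ∑ q : G.V × H.V, G.μ p.1 q.1 * H.μ p.2 q.2
        = ∑ p : G.U × H.U, (∑ v, G.μ p.1 v) * (∑ v', H.μ p.2 v') := by
          refine Finset.sum_congr rfl fun p _ => ?_
          rw [Fintype.sum_prod_type, Finset.sum_mul_sum]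
      _ = (∑ u, ∑ v, G.μ u v) * (∑ u', ∑ v', H.μ u' v') := by
          rw [Fintype.sum_prod_type, Finset.sum_mul_sum]
      _ = 1 := by rw [h1, h2, one_mul]
  proj := fun p q b =>
    (G.proj p.1 q.1 b.1).bind fun a => (H.proj p.2 q.2 b.2).map fun a' => (a, a')

/-- The `k`-fold repetition `G^{⊗k}` (junk value `G` at `k = 0`). -/
def pow : ℕ → ProjGame
  | 0 => G
  | 1 => G
  | (n+2) => G.prod (pow (n+1))

/-- The normalized Laplacian of the square of the constraint graph of `G`. -/
def lap [DecidableEq G.V] : Matrix G.V G.V ℝ :=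
  1 - Matrix.of fun v v' =>
    (Real.sqrt (G.μR v))⁻¹ * (∑ u, G.μL u * G.μc u v * G.μc u v') * (Real.sqrt (G.μR v'))⁻¹

end ProjGame

open scoped MatrixOrder Matrix.Norms.L2Operator in
theorem opNorm_le_iff_posSemidef {n : Type*} [Fintype n] [DecidableEq n] {M : Matrix n n ℂ}
    (hM : M.PosSemidef) {c : ℝ} (hc : 0 ≤ c) :
    opNorm M ≤ c ↔ ((c : ℂ) • (1 : Matrix n n ℂ) - M).PosSemidef := by
  have h := CStarAlgebra.norm_le_iff_le_algebraMap M hc hM.nonneg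
  rw [Matrix.le_iff, Algebra.algebraMap_eq_smul_one] at h
  exact h

theorem opNorm_nonneg {n : Type*} [Fintype n] [DecidableEq n] (M : Matrix n n ℂ) :
    0 ≤ opNorm M := norm_nonneg _

theorem opNorm_smul {n : Type*} [Fintype n] [DecidableEq n] {c : ℝ} (hc : 0 ≤ c)
    (M : Matrix n n ℂ) : opNorm ((c : ℂ) • M) = c * opNorm M := by
  rw [opNorm, map_smul, norm_smul, Complex.norm_real, Real.norm_of_nonneg hc, opNorm]

theorem Matrix.sub_kronecker {ι κ : Type*} (M N : Matrix ι ι ℂ) (K : Matrix κ κ ℂ) :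
    (M - N) ⊗ₖ K = M ⊗ₖ K - N ⊗ₖ K := by
  ext
  simp [kroneckerMap_apply, sub_mul]

theorem Matrix.kronecker_sub {ι κ : Type*} (K : Matrix κ κ ℂ) (M N : Matrix ι ι ℂ) :
    K ⊗ₖ (M - N) = K ⊗ₖ M - K ⊗ₖ N := by
  ext
  simp [kroneckerMap_apply, mul_sub]

section Braket

variable {ι : Type*} [Fintype ι]

theorem braket_sub_right (ψ : ι → ℂ) (M N : Matrix ι ι ℂ) :
    braket ψ (M - N) = braket ψ M - braket ψ N := by
  simp [braket, sub_mulVec]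

theorem braket_smul_right (ψ : ι → ℂ) (c : ℂ) (M : Matrix ι ι ℂ) :
    braket ψ (c • M) = c * braket ψ M := by
  simp [braket, smul_mulVec]

theorem braket_sum_right {κ : Type*} (s : Finset κ) (ψ : ι → ℂ) (M : κ → Matrix ι ι ℂ) :
    braket ψ (∑ k ∈ s, M k) = ∑ k ∈ s, braket ψ (M k) := by
  simp [braket, sum_mulVec, dotProduct_sum]

theorem braket_smul_left (ψ : ι → ℂ) (c : ℂ) (M : Matrix ι ι ℂ) :
    braket (c • ψ) M = (Complex.normSq c : ℂ) * braket ψ M := by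
  simp [braket, mulVec_smul, Complex.normSq_eq_conj_mul_self]
  ring

theorem braket_one [DecidableEq ι] (ψ : ι → ℂ) : braket ψ 1 = (enormSq ψ : ℂ) := by
  simp [braket, enormSq, dotProduct, Complex.normSq_eq_conj_mul_self]

theorem enormSq_nonneg (ψ : ι → ℂ) : 0 ≤ enormSq ψ :=
  Finset.sum_nonneg fun _ _ => Complex.normSq_nonneg _

theorem braket_re_nonneg {M : Matrix ι ι ℂ} (hM : M.PosSemidef) (ψ : ι → ℂ) :
    0 ≤ (braket ψ M).re :=
  (Complex.le_def.1 (hM.dotProduct_mulVec_nonneg ψ)).1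

theorem braket_sub_re_le {M : Matrix ι ι ℂ} (hM : M.PosSemidef) (ψ φ : ι → ℂ) :
    (braket (ψ - φ) M).re ≤ 2 * (braket ψ M).re + 2 * (braket φ M).re := by
  have h := braket_re_nonneg hM (ψ + φ)
  simp only [braket, star_add, star_sub, mulVec_add, mulVec_sub, add_dotProduct, sub_dotProduct,
    dotProduct_add, dotProduct_sub, Complex.add_re, Complex.sub_re] at h ⊢
  linarith

theorem braket_add_re_le {M : Matrix ι ι ℂ} (hM : M.PosSemidef) (ψ φ : ι → ℂ) :
    (braket (ψ + φ) M).re ≤ 2 * (braket ψ M).re + 2 * (braket φ M).re := by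
  have h := braket_re_nonneg hM (ψ - φ)
  simp only [braket, star_add, star_sub, mulVec_add, mulVec_sub, add_dotProduct, sub_dotProduct,
    dotProduct_add, dotProduct_sub, Complex.add_re, Complex.sub_re] at h ⊢
  linarith

theorem opNorm_le_iff_braket [DecidableEq ι] {M : Matrix ι ι ℂ}
    (hM : M.PosSemidef) {c : ℝ} (hc : 0 ≤ c) :
    opNorm M ≤ c ↔ ∀ ψ, (braket ψ M).re ≤ c * enormSq ψ := by
  have key : ∀ ψ, braket ψ ((c : ℂ) • (1 : Matrix ι ι ℂ) - M)
      = ((c * enormSq ψ : ℝ) : ℂ) - braket ψ M := fun ψ => by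
    rw [braket_sub_right, braket_smul_right, braket_one]; push_cast; rfl
  rw [opNorm_le_iff_posSemidef hM hc]
  constructor
  · intro h ψ
    have := braket_re_nonneg h ψ
    rw [key, Complex.sub_re, Complex.ofReal_re] at this
    linarith
  · intro h
    have hH : ((c : ℂ) • (1 : Matrix ι ι ℂ) - M).IsHermitian := by
      refine IsHermitian.sub ?_ hM.1
      simp [IsHermitian, conjTranspose_smul]
    refine PosSemidef.of_dotProduct_mulVec_nonneg hH fun ψ => ?_
    change 0 ≤ braket ψ _
    have him : (braket ψ M).im = 0 := ((Complex.le_def.1 (hM.dotProduct_mulVec_nonneg ψ)).2).symm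
    rw [key, Complex.le_def]
    simp only [Complex.zero_re, Complex.sub_re, Complex.ofReal_re, Complex.zero_im,
      Complex.sub_im, Complex.ofReal_im, him, sub_self, and_true]
    linarith [h ψ]

theorem opNorm_le_of_sub_posSemidef [DecidableEq ι] {M N : Matrix ι ι ℂ} (hM : M.PosSemidef)
    (h : (N - M).PosSemidef) : opNorm M ≤ opNorm N := by
  have hN : N.PosSemidef := by simpa using h.add hM
  rw [opNorm_le_iff_braket hM (opNorm_nonneg _)]
  intro ψ
  have h1 := (opNorm_le_iff_braket hN (opNorm_nonneg N)).1 le_rfl ψ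
  have h2 := braket_re_nonneg h ψ
  rw [braket_sub_right, Complex.sub_re] at h2
  linarith

theorem opNorm_submatrix_equiv [DecidableEq ι] {κ : Type*} [Fintype κ] [DecidableEq κ]
    {M : Matrix ι ι ℂ} (hM : M.PosSemidef) (e : κ ≃ ι) :
    opNorm (M.submatrix e e) = opNorm M := by
  have key : ∀ c : ℝ, 0 ≤ c → (opNorm (M.submatrix e e) ≤ c ↔ opNorm M ≤ c) := fun c hc => by
    rw [opNorm_le_iff_posSemidef (hM.submatrix e) hc, opNorm_le_iff_posSemidef hM hc,
      ← posSemidef_submatrix_equiv e]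
    simp [submatrix_sub, submatrix_smul]
  exact le_antisymm ((key _ (opNorm_nonneg _)).2 le_rfl) ((key _ (opNorm_nonneg _)).1 le_rfl)

theorem braket_kronecker {κ : Type*} [Fintype κ] (ψ : ι → ℂ) (φ : κ → ℂ)
    (M : Matrix ι ι ℂ) (N : Matrix κ κ ℂ) :
    braket (fun p : ι × κ => ψ p.1 * φ p.2) (M ⊗ₖ N) = braket ψ M * braket φ N := by
  have h : (M ⊗ₖ N).mulVec (fun p : ι × κ => ψ p.1 * φ p.2)
      = fun p => M.mulVec ψ p.1 * N.mulVec φ p.2 := by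
    ext p
    simp only [mulVec, dotProduct, Fintype.sum_prod_type, Finset.sum_mul_sum, kroneckerMap_apply]
    exact Finset.sum_congr rfl fun _ _ => Finset.sum_congr rfl fun _ _ => by ring
  rw [braket, h]
  simp only [braket, dotProduct, Fintype.sum_prod_type, Finset.sum_mul_sum, Pi.star_apply, star_mul']
  exact Finset.sum_congr rfl fun _ _ => Finset.sum_congr rfl fun _ _ => by ring

theorem enormSq_mul {κ : Type*} [Fintype κ] (ψ : ι → ℂ) (φ : κ → ℂ) :
    enormSq (fun p : ι × κ => ψ p.1 * φ p.2) = enormSq ψ * enormSq φ := by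
  simp [enormSq, Fintype.sum_prod_type, Finset.sum_mul_sum]

theorem opNorm_kronecker [DecidableEq ι] {κ : Type*} [Fintype κ] [DecidableEq κ]
    {M : Matrix ι ι ℂ} {N : Matrix κ κ ℂ} (hM : M.PosSemidef) (hN : N.PosSemidef) :
    opNorm (M ⊗ₖ N) = opNorm M * opNorm N := by
  apply le_antisymm
  · rw [opNorm_le_iff_posSemidef (hM.kronecker hN) (mul_nonneg (opNorm_nonneg _) (opNorm_nonneg _))]
    have h1 := (opNorm_le_iff_posSemidef hM (opNorm_nonneg M)).1 le_rfl
    have h2 := (opNorm_le_iff_posSemidef hN (opNorm_nonneg N)).1 le_rfl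
    have h3 : (((opNorm N : ℝ) : ℂ) • (1 : Matrix κ κ ℂ)).PosSemidef :=
      PosSemidef.one.smul (Complex.zero_le_real.2 (opNorm_nonneg N))
    have h : ((opNorm M * opNorm N : ℝ) : ℂ) • (1 : Matrix (ι × κ) (ι × κ) ℂ) - M ⊗ₖ N
        = ((opNorm M : ℂ) • (1 : Matrix ι ι ℂ) - M) ⊗ₖ ((opNorm N : ℂ) • (1 : Matrix κ κ ℂ))
          + M ⊗ₖ ((opNorm N : ℂ) • (1 : Matrix κ κ ℂ) - N) := by
      rw [sub_kronecker, kronecker_sub, smul_kronecker, kronecker_smul, one_kronecker_one,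
        smul_smul, Complex.ofReal_mul]
      abel
    rw [h]
    exact (h1.kronecker h3).add (hM.kronecker h2)
  · set c := opNorm (M ⊗ₖ N) with hc
    have hc0 : 0 ≤ c := opNorm_nonneg _
    have key := (opNorm_le_iff_braket (hM.kronecker hN) hc0).1 le_rfl
    have hre : ∀ ψ φ, (braket ψ M).re * (braket φ N).re ≤ c * (enormSq ψ * enormSq φ) := by
      intro ψ φ
      have := key fun p : ι × κ => ψ p.1 * φ p.2
      have him : (braket ψ M).im = 0 :=
        ((Complex.le_def.1 (hM.dotProduct_mulVec_nonneg ψ)).2).symm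
      rwa [braket_kronecker, enormSq_mul, Complex.mul_re, him, zero_mul, sub_zero] at this
    have step : ∀ φ, opNorm M * (braket φ N).re ≤ c * enormSq φ := by
      intro φ
      have h0 := braket_re_nonneg hN φ
      rw [mul_comm, ← opNorm_smul h0, opNorm_le_iff_braket (hM.smul (Complex.zero_le_real.2 h0))
        (mul_nonneg hc0 (enormSq_nonneg _))]
      intro ψ
      rw [braket_smul_right, Complex.re_ofReal_mul]
      linarith [hre ψ φ]
    rw [← opNorm_smul (opNorm_nonneg M),
      opNorm_le_iff_braket (hN.smul (Complex.zero_le_real.2 (opNorm_nonneg M))) hc0]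
    intro φ
    rw [braket_smul_right, Complex.re_ofReal_mul]
    exact step φ

end Braket

theorem mconj_posSemidef {n : Type*} [Fintype n] {M : Matrix n n ℂ} (hM : M.PosSemidef) :
    (mconj M).PosSemidef := hM.conjTranspose.transpose

theorem mconj_kronecker_sub_posSemidef {n : Type*} [Fintype n] {X Y Z W : Matrix n n ℂ}
    (hX : X.PosSemidef) (hW : W.PosSemidef) (hXZ : (Z - X).PosSemidef)
    (hYW : (W - Y).PosSemidef) : (mconj Z ⊗ₖ W - mconj X ⊗ₖ Y).PosSemidef := by
  have h : mconj Z ⊗ₖ W - mconj X ⊗ₖ Y = mconj (Z - X) ⊗ₖ W + mconj X ⊗ₖ (W - Y) := by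
    have : mconj (Z - X) = mconj Z - mconj X := by ext; simp [mconj]
    rw [this, sub_kronecker, kronecker_sub]
    abel
  rw [h]
  exact ((mconj_posSemidef hXZ).kronecker hW).add ((mconj_posSemidef hX).kronecker hYW)

section Hermitian

variable {n : Type*} [Fintype n]

theorem ofReal_enormSq_vec (K : Matrix n n ℂ) : (enormSq K.vec : ℂ) = (Kᴴ * K).trace := by
  classical
  rw [← star_vec_dotProduct_vec, ← braket_one, braket, one_mulVec]

theorem braket_vec_mconj_kronecker (K X Y : Matrix n n ℂ) (hX : X.IsHermitian) :
    braket K.vec (mconj X ⊗ₖ Y) = (Kᴴ * (Y * K * X)).trace := by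
  have : (mconj X)ᵀ = X := hX
  rw [braket, kronecker_mulVec_vec, star_vec_dotProduct_vec, this]

theorem braket_vec_conjTranspose_mul_self (B X : Matrix n n ℂ) (hX : X.IsHermitian) :
    braket (Bᴴ * B).vec (mconj X ⊗ₖ X) = (enormSq (B * X * Bᴴ).vec : ℂ) := by
  rw [braket_vec_mconj_kronecker _ _ _ hX, ofReal_enormSq_vec]
  simp only [conjTranspose_mul, conjTranspose_conjTranspose, hX.eq]
  rw [Matrix.mul_assoc, Matrix.trace_mul_comm]
  simp only [Matrix.mul_assoc]

open scoped MatrixOrder in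
theorem Matrix.IsHermitian.exists_posSemidef_sub {H : Matrix n n ℂ} (hH : H.IsHermitian) :
    ∃ P N : Matrix n n ℂ, P.PosSemidef ∧ N.PosSemidef ∧ H = P - N ∧
      enormSq H.vec = enormSq P.vec + enormSq N.vec := by
  classical
  have hP : (H⁺).PosSemidef := (CFC.posPart_nonneg H).posSemidef
  have hN : (H⁻).PosSemidef := (CFC.negPart_nonneg H).posSemidef
  have hs : H⁺ - H⁻ = H := CFC.posPart_sub_negPart H hH
  refine ⟨H⁺, H⁻, hP, hN, hs.symm, ?_⟩
  have h1 := CFC.posPart_mul_negPart H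
  have h2 := CFC.negPart_mul_posPart H
  apply Complex.ofReal_injective
  push_cast
  simp only [ofReal_enormSq_vec, hH.eq, hP.1.eq, hN.1.eq]
  conv_lhs => rw [← hs]
  simp [sub_mul, mul_sub, h1, h2]

theorem braket_vec_le_of_isHermitian {M : Matrix (n × n) (n × n) ℂ} (hM : M.PosSemidef) {c : ℝ}
    (h : ∀ K : Matrix n n ℂ, K.PosSemidef → (braket K.vec M).re ≤ c * enormSq K.vec)
    {H : Matrix n n ℂ} (hH : H.IsHermitian) :
    (braket H.vec M).re ≤ 2 * c * enormSq H.vec := by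
  obtain ⟨P, N, hP, hN, hs, he⟩ := hH.exists_posSemidef_sub
  rw [he]
  have := braket_sub_re_le hM P.vec N.vec
  rw [← vec_sub, ← hs] at this
  linarith [h P hP, h N hN]

theorem enormSq_vec_conjTranspose (K : Matrix n n ℂ) : enormSq (Kᴴ).vec = enormSq K.vec := by
  apply Complex.ofReal_injective
  rw [ofReal_enormSq_vec, ofReal_enormSq_vec, conjTranspose_conjTranspose, trace_mul_comm]

theorem enormSq_vec_smul (z : ℂ) (K : Matrix n n ℂ) :
    enormSq (z • K).vec = Complex.normSq z * enormSq K.vec := by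
  simp [enormSq, Finset.mul_sum]

theorem opNorm_le_of_posSemidef_vec [DecidableEq n] {M : Matrix (n × n) (n × n) ℂ}
    (hM : M.PosSemidef) {c : ℝ} (hc : 0 ≤ c)
    (h : ∀ K : Matrix n n ℂ, K.PosSemidef → (braket K.vec M).re ≤ c * enormSq K.vec) :
    opNorm M ≤ 8 * c := by
  rw [opNorm_le_iff_braket hM (by positivity)]
  intro ψ
  obtain ⟨K, rfl⟩ := (vec_bijective (R := ℂ) (m := n) (n := n)).surjective ψ
  set R : Matrix n n ℂ := (1 / 2 : ℂ) • (K + Kᴴ) with hRdef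
  set S : Matrix n n ℂ := (Complex.I / 2) • (Kᴴ - K) with hSdef
  have hR : R.IsHermitian := by
    simp [IsHermitian, R, conjTranspose_smul, add_comm]
  have hS : S.IsHermitian := by
    simp only [IsHermitian, S, conjTranspose_smul, conjTranspose_sub, conjTranspose_conjTranspose]
    rw [← neg_sub, smul_neg, ← neg_smul]
    congr 1
    simp [neg_div]
  have hK : K = R + Complex.I • S := by
    ext i j
    simp only [R, S, Matrix.add_apply, Matrix.sub_apply, Matrix.smul_apply, smul_eq_mul]
    linear_combination (-(1 / 2 : ℂ) * ((Kᴴ) i j - K i j)) * Complex.I_sq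
  have hRn : enormSq R.vec ≤ enormSq K.vec := by
    have := braket_add_re_le (PosSemidef.one (n := n × n) (R := ℂ)) K.vec (Kᴴ).vec
    rw [← vec_add] at this
    simp only [braket_one, Complex.ofReal_re, enormSq_vec_conjTranspose] at this
    rw [hRdef, enormSq_vec_smul]
    have : Complex.normSq (1 / 2 : ℂ) = 1 / 4 := by norm_num [Complex.normSq]
    rw [this]
    linarith
  have hSn : enormSq S.vec ≤ enormSq K.vec := by
    have := braket_sub_re_le (PosSemidef.one (n := n × n) (R := ℂ)) (Kᴴ).vec K.vec
    rw [← vec_sub] at this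
    simp only [braket_one, Complex.ofReal_re, enormSq_vec_conjTranspose] at this
    rw [hSdef, enormSq_vec_smul]
    have : Complex.normSq (Complex.I / 2 : ℂ) = 1 / 4 := by norm_num
    rw [this]
    linarith
  have h1 := braket_vec_le_of_isHermitian hM h hR
  have h2 := braket_vec_le_of_isHermitian hM h hS
  clear_value R S
  have h3 := braket_add_re_le hM R.vec (Complex.I • S.vec)
  rw [← vec_smul, ← vec_add, ← hK, vec_smul, braket_smul_left] at h3
  simp only [Complex.normSq_I, Complex.ofReal_one, one_mul] at h3
  have h4 := mul_le_mul_of_nonneg_left hRn hc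
  have h5 := mul_le_mul_of_nonneg_left hSn hc
  linarith

end Hermitian

theorem enormSq_sum_le {ι κ : Type*} [Fintype ι] [Fintype κ] (f : κ → ι → ℂ) :
    enormSq (∑ k, f k) ≤ Fintype.card κ * ∑ k, enormSq (f k) := by
  unfold enormSq
  rw [Finset.sum_comm, Finset.mul_sum]
  refine Finset.sum_le_sum fun i _ => ?_
  simp only [Complex.normSq_eq_norm_sq, Finset.sum_apply]
  calc ‖∑ k, f k i‖ ^ 2 ≤ (∑ k, ‖f k i‖) ^ 2 := by gcongr; exact norm_sum_le _ _
    _ ≤ _ := sq_sum_le_card_mul_sum_sq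

open scoped MatrixOrder in
theorem opNorm_sum_mconj_kronecker_sum_le {Ω κ n : Type*} [Fintype Ω] [Fintype κ] [Fintype n]
    [DecidableEq n] {w : Ω → ℝ} (hw : ∀ i, 0 ≤ w i) {A : Ω → κ → Matrix n n ℂ}
    (hA : ∀ i k, (A i k).PosSemidef) {c : ℝ} (hc : 0 ≤ c)
    (h : ∀ k, opNorm (∑ i, (w i : ℂ) • (mconj (A i k) ⊗ₖ A i k)) ≤ c) :
    opNorm (∑ i, (w i : ℂ) • (mconj (∑ k, A i k) ⊗ₖ ∑ k, A i k)) ≤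
      8 * (Fintype.card κ * (Fintype.card κ * c)) := by
  have hpsd : ∀ X : Ω → Matrix n n ℂ, (∀ i, (X i).PosSemidef) →
      (∑ i, (w i : ℂ) • (mconj (X i) ⊗ₖ X i)).PosSemidef := fun X hX =>
    posSemidef_sum _ fun i _ =>
      ((mconj_posSemidef (hX i)).kronecker (hX i)).smul (Complex.zero_le_real.2 (hw i))
  have hsum : ∀ i, (∑ k, A i k).PosSemidef := fun i => posSemidef_sum _ fun k _ => hA i k
  refine opNorm_le_of_posSemidef_vec (hpsd _ hsum) (by positivity) fun K hK => ?_
  obtain ⟨B, rfl⟩ : ∃ B, K = Bᴴ * B := CStarAlgebra.nonneg_iff_eq_star_mul_self.1 hK.nonneg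
  have key : ∀ X : Ω → Matrix n n ℂ, (∀ i, (X i).PosSemidef) →
      (braket (Bᴴ * B).vec (∑ i, (w i : ℂ) • (mconj (X i) ⊗ₖ X i))).re
        = ∑ i, w i * enormSq (B * X i * Bᴴ).vec := fun X hX => by
    rw [braket_sum_right, Complex.re_sum]
    refine Finset.sum_congr rfl fun i _ => ?_
    rw [braket_smul_right, braket_vec_conjTranspose_mul_self _ _ (hX i).1, Complex.re_ofReal_mul,
      Complex.ofReal_re]
  rw [key _ hsum]
  calc ∑ i, w i * enormSq (B * (∑ k, A i k) * Bᴴ).vec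
      ≤ ∑ i, w i * (Fintype.card κ * ∑ k, enormSq (B * A i k * Bᴴ).vec) := by
        refine Finset.sum_le_sum fun i _ => mul_le_mul_of_nonneg_left ?_ (hw i)
        rw [Finset.mul_sum, Finset.sum_mul, vec_sum]
        exact enormSq_sum_le _
    _ = Fintype.card κ * ∑ k, ∑ i, w i * enormSq (B * A i k * Bᴴ).vec := by
        rw [Finset.sum_comm, Finset.mul_sum]
        refine Finset.sum_congr rfl fun i _ => ?_
        rw [Finset.mul_sum, Finset.mul_sum, Finset.mul_sum]
        exact Finset.sum_congr rfl fun k _ => by ring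
    _ ≤ Fintype.card κ * ∑ _k : κ, c * enormSq (Bᴴ * B).vec := by
        refine mul_le_mul_of_nonneg_left (Finset.sum_le_sum fun k _ => ?_) (by positivity)
        rw [← key _ fun i => hA i k]
        exact (opNorm_le_iff_braket (hpsd _ fun i => hA i k) hc).1 (h k) _
    _ = _ := by
        rw [Finset.sum_const, Finset.card_univ, nsmul_eq_mul]
        ring

section KronReindex

variable {α β γ : Type*}

/-- The Kronecker product of two square matrices, with rows and columns relabelled along an
equivalence, as a bilinear map. -/
def kronReindex (e : γ ≃ α × β) :
    Matrix α α ℂ →ₗ[ℂ] Matrix β β ℂ →ₗ[ℂ] Matrix γ γ ℂ :=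
  LinearMap.mk₂ ℂ (fun X Y => (X ⊗ₖ Y).submatrix e e)
    (fun X X' Y => by rw [add_kronecker, submatrix_add]; rfl)
    (fun c X Y => by rw [smul_kronecker, submatrix_smul]; rfl)
    (fun X Y Y' => by rw [kronecker_add, submatrix_add]; rfl)
    (fun c X Y => by rw [kronecker_smul, submatrix_smul]; rfl)

theorem kronReindex_apply (e : γ ≃ α × β) (X : Matrix α α ℂ) (Y : Matrix β β ℂ) :
    kronReindex e X Y = (X ⊗ₖ Y).submatrix e e := rfl

theorem kronReindex_sum_sum {ι κ : Type*} [Fintype ι] [Fintype κ] (e : γ ≃ α × β)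
    (X : ι → Matrix α α ℂ) (Y : κ → Matrix β β ℂ) :
    kronReindex e (∑ i, X i) (∑ j, Y j) = ∑ p : ι × κ, kronReindex e (X p.1) (Y p.2) := by
  simp only [map_sum, LinearMap.sum_apply, Fintype.sum_prod_type]
  exact Finset.sum_comm

theorem kronReindex_smul_smul (e : γ ≃ α × β) (r s : ℝ) (X : Matrix α α ℂ) (Y : Matrix β β ℂ) :
    kronReindex e ((r : ℂ) • X) ((s : ℂ) • Y) = ((r * s : ℝ) : ℂ) • kronReindex e X Y := by
  rw [map_smul, map_smul, LinearMap.smul_apply, smul_smul, Complex.ofReal_mul, mul_comm]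

theorem mconj_kronReindex_kronecker (e : γ ≃ α × β) (X : Matrix α α ℂ) (Y : Matrix β β ℂ) :
    mconj (kronReindex e X Y) ⊗ₖ kronReindex e X Y =
      kronReindex ((e.prodCongr e).trans (Equiv.prodProdProdComm α β α β))
        (mconj X ⊗ₖ X) (mconj Y ⊗ₖ Y) := by
  ext ⟨i, j⟩ ⟨k, l⟩
  simp [kronReindex_apply, mconj, kroneckerMap_apply]
  ring

variable [Fintype α] [Fintype β]

theorem kronReindex_posSemidef (e : γ ≃ α × β) {X : Matrix α α ℂ} {Y : Matrix β β ℂ}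
    (hX : X.PosSemidef) (hY : Y.PosSemidef) : (kronReindex e X Y).PosSemidef :=
  (hX.kronecker hY).submatrix e

theorem one_sub_kronReindex_posSemidef [DecidableEq α] [DecidableEq β] [DecidableEq γ]
    (e : γ ≃ α × β) {X : Matrix α α ℂ} {Y : Matrix β β ℂ}
    (hX : X.PosSemidef) (hX' : (1 - X).PosSemidef) (hY' : (1 - Y).PosSemidef) :
    (1 - kronReindex e X Y).PosSemidef := by
  have h : 1 - kronReindex e X Y = kronReindex e (1 - X) 1 + kronReindex e X (1 - Y) := by
    have h1 : kronReindex e (1 : Matrix α α ℂ) (1 : Matrix β β ℂ) = 1 := by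
      rw [kronReindex_apply, one_kronecker_one, submatrix_one_equiv]
    rw [map_sub, map_sub, LinearMap.sub_apply, h1]
    abel
  rw [h]
  exact (kronReindex_posSemidef e hX' PosSemidef.one).add (kronReindex_posSemidef e hX hY')

theorem opNorm_kronReindex [DecidableEq α] [DecidableEq β] [Fintype γ] [DecidableEq γ]
    (e : γ ≃ α × β) {X : Matrix α α ℂ} {Y : Matrix β β ℂ}
    (hX : X.PosSemidef) (hY : Y.PosSemidef) :
    opNorm (kronReindex e X Y) = opNorm X * opNorm Y := by
  rw [kronReindex_apply, opNorm_submatrix_equiv (hX.kronecker hY), opNorm_kronecker hX hY]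

end KronReindex

theorem mul_sSup_le {x P : ℝ} {T : Set ℝ} (hx : 0 ≤ x) (hT : T.Nonempty) (hP : 0 ≤ P)
    (h : ∀ y ∈ T, x * y ≤ P) : x * sSup T ≤ P := by
  rcases hx.eq_or_lt with rfl | hx
  · simpa using hP
  · rw [← le_div_iff₀' hx]
    exact csSup_le hT fun y hy => (le_div_iff₀' hx).2 (h y hy)

theorem Real.sqrt_le_one_iff_le_one {x : ℝ} : √x ≤ 1 ↔ x ≤ 1 := by
  rw [Real.sqrt_le_iff]
  norm_num

namespace ProjGame

variable (G H : ProjGame)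

theorem μL_nonneg (u : G.U) : 0 ≤ G.μL u := Finset.sum_nonneg fun v _ => G.μ_nonneg u v

theorem sum_μL : ∑ u, G.μL u = 1 := G.μ_sum

theorem μc_nonneg (u : G.U) (v : G.V) : 0 ≤ G.μc u v := div_nonneg (G.μ_nonneg u v) (G.μL_nonneg u)

theorem sum_μc_le_one (u : G.U) : ∑ v, G.μc u v ≤ 1 := by
  simp only [μc, ← Finset.sum_div]
  exact div_self_le_one _

theorem μc_le_one (u : G.U) (v : G.V) : G.μc u v ≤ 1 :=
  (Finset.single_le_sum (fun v _ => G.μc_nonneg u v) (Finset.mem_univ v)).trans (G.sum_μc_le_one u)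

theorem μL_prod (p : G.U × H.U) : (G.prod H).μL p = G.μL p.1 * H.μL p.2 := by
  change ∑ q : G.V × H.V, G.μ p.1 q.1 * H.μ p.2 q.2 = _
  rw [Fintype.sum_prod_type, μL, μL, Finset.sum_mul_sum]

theorem μc_prod (p : G.U × H.U) (q : G.V × H.V) :
    (G.prod H).μc p q = G.μc p.1 q.1 * H.μc p.2 q.2 := by
  have h : (G.prod H).μc p q = G.μ p.1 q.1 * H.μ p.2 q.2 / (G.prod H).μL p := rfl
  rw [h, μL_prod]
  exact mul_div_mul_comm _ _ _ _

theorem proj_prod_eq_some_iff (p : G.U × H.U) (q : G.V × H.V) (b : G.B × H.B) (a : G.A × H.A) :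
    (G.prod H).proj p q b = some a ↔
      G.proj p.1 q.1 b.1 = some a.1 ∧ H.proj p.2 q.2 b.2 = some a.2 := by
  change (G.proj p.1 q.1 b.1).bind (fun a => (H.proj p.2 q.2 b.2).map fun a' => (a, a'))
    = some a ↔ _
  cases G.proj p.1 q.1 b.1 <;> cases H.proj p.2 q.2 b.2 <;> simp [Prod.ext_iff]

variable {G H} {d d' : ℕ}

theorem smul_ite_posSemidef {A : G.V → G.B → Mat d} (hA : ∀ v b, (A v b).PosSemidef)
    (u : G.U) (a : G.A) (v : G.V) (b : G.B) :
    (if G.proj u v b = some a then (G.μc u v : ℂ) • A v b else 0).PosSemidef := by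
  split_ifs
  · exact (hA v b).smul (Complex.zero_le_real.2 (G.μc_nonneg u v))
  · exact PosSemidef.zero

theorem Bop_posSemidef {A : G.V → G.B → Mat d} (hA : ∀ v b, (A v b).PosSemidef)
    (u : G.U) (a : G.A) : (G.Bop A u a).PosSemidef :=
  posSemidef_sum _ fun v _ => posSemidef_sum _ fun b _ => smul_ite_posSemidef hA u a v b

theorem sum_smul_sub_Bop_posSemidef {A : G.V → G.B → Mat d} (hA : ∀ v b, (A v b).PosSemidef)
    (u : G.U) (a : G.A) :
    (∑ v, (G.μc u v : ℂ) • ∑ b, A v b - G.Bop A u a).PosSemidef := by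
  simp only [Bop, Finset.smul_sum, ← Finset.sum_sub_distrib]
  refine posSemidef_sum _ fun v _ => posSemidef_sum _ fun b _ => ?_
  split_ifs
  · rw [sub_self]; exact PosSemidef.zero
  · rw [sub_zero]; exact (hA v b).smul (Complex.zero_le_real.2 (G.μc_nonneg u v))

theorem sum_sub_Bop_posSemidef {A : G.V → G.B → Mat d} (hA : ∀ v b, (A v b).PosSemidef)
    (u : G.U) (a : G.A) : (∑ v, ∑ b, A v b - G.Bop A u a).PosSemidef := by
  have h : (∑ v, ∑ b, A v b - ∑ v, (G.μc u v : ℂ) • ∑ b, A v b).PosSemidef := by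
    rw [← Finset.sum_sub_distrib]
    refine posSemidef_sum _ fun v _ => ?_
    have : ∑ b, A v b - (G.μc u v : ℂ) • ∑ b, A v b = ((1 - G.μc u v : ℝ) : ℂ) • ∑ b, A v b := by
      push_cast; rw [sub_smul, one_smul]
    rw [this]
    exact (posSemidef_sum _ fun b _ => hA v b).smul
      (Complex.zero_le_real.2 (sub_nonneg.2 (G.μc_le_one u v)))
  simpa using h.add (sum_smul_sub_Bop_posSemidef hA u a)

theorem one_sub_Bop_posSemidef {A : G.V → G.B → Mat d} (hA : ∀ v b, (A v b).PosSemidef)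
    (hA' : ∀ v, (1 - ∑ b, A v b).PosSemidef) (u : G.U) (a : G.A) :
    (1 - G.Bop A u a).PosSemidef := by
  have h1 : (((1 - ∑ v, G.μc u v : ℝ) : ℂ) • (1 : Mat d)).PosSemidef :=
    PosSemidef.one.smul (Complex.zero_le_real.2 (sub_nonneg.2 (G.sum_μc_le_one u)))
  have h2 : (∑ v, (G.μc u v : ℂ) • (1 - ∑ b, A v b)).PosSemidef :=
    posSemidef_sum _ fun v _ => (hA' v).smul (Complex.zero_le_real.2 (G.μc_nonneg u v))
  have h : 1 - G.Bop A u a = ((1 - ∑ v, G.μc u v : ℝ) : ℂ) • (1 : Mat d)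
      + ∑ v, (G.μc u v : ℂ) • (1 - ∑ b, A v b)
      + (∑ v, (G.μc u v : ℂ) • ∑ b, A v b - G.Bop A u a) := by
    simp only [smul_sub, Finset.sum_sub_distrib, ← Finset.sum_smul]
    push_cast
    rw [sub_smul, one_smul]
    abel
  rw [h]
  exact (h1.add h2).add (sum_smul_sub_Bop_posSemidef hA u a)

theorem sqMat_posSemidef {A : G.V → G.B → Mat d} (hA : ∀ v b, (A v b).PosSemidef) :
    (G.sqMat A).PosSemidef :=
  posSemidef_sum _ fun u _ => (posSemidef_sum _ fun a _ =>
    (mconj_posSemidef (Bop_posSemidef hA u a)).kronecker (Bop_posSemidef hA u a)).smul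
      (Complex.zero_le_real.2 (G.μL_nonneg u))

theorem card_smul_sub_sqMat_posSemidef {A : G.V → G.B → Mat d}
    (hA : ∀ v b, (A v b).PosSemidef) :
    (((Fintype.card G.A : ℝ) : ℂ) • (mconj (∑ v, ∑ b, A v b) ⊗ₖ ∑ v, ∑ b, A v b)
      - G.sqMat A).PosSemidef := by
  have hZ : (∑ v, ∑ b, A v b).PosSemidef :=
    posSemidef_sum _ fun v _ => posSemidef_sum _ fun b _ => hA v b
  have h : ((Fintype.card G.A : ℝ) : ℂ) • (mconj (∑ v, ∑ b, A v b) ⊗ₖ ∑ v, ∑ b, A v b)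
      = ∑ u, (G.μL u : ℂ) • ∑ _a : G.A, mconj (∑ v, ∑ b, A v b) ⊗ₖ ∑ v, ∑ b, A v b := by
    rw [← Finset.sum_smul, ← Complex.ofReal_sum, sum_μL, Complex.ofReal_one, one_smul,
      Finset.sum_const, Finset.card_univ, Complex.ofReal_natCast, Nat.cast_smul_eq_nsmul]
  rw [h, sqMat, ← Finset.sum_sub_distrib]
  refine posSemidef_sum _ fun u _ => ?_
  rw [← smul_sub, ← Finset.sum_sub_distrib]
  refine (posSemidef_sum _ fun a _ => ?_).smul (Complex.zero_le_real.2 (G.μL_nonneg u))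
  exact mconj_kronecker_sub_posSemidef (Bop_posSemidef hA u a) hZ (sum_sub_Bop_posSemidef hA u a)
    (sum_sub_Bop_posSemidef hA u a)

theorem Bop_map (f : Mat d →ₗ[ℂ] Mat d') (A : G.V → G.B → Mat d) (u : G.U) (a : G.A) :
    G.Bop (fun v b => f (A v b)) u a = f (G.Bop A u a) := by
  simp only [Bop, map_sum, apply_ite f, map_smul, map_zero]

theorem sum_Bop {κ : Type*} [Fintype κ] (A : κ → G.V → G.B → Mat d) (u : G.U) (a : G.A) :
    ∑ k, G.Bop (A k) u a = G.Bop (fun v b => ∑ k, A k v b) u a := by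
  simp only [Bop]
  rw [Finset.sum_comm]
  refine Finset.sum_congr rfl fun v _ => ?_
  rw [Finset.sum_comm]
  refine Finset.sum_congr rfl fun b _ => ?_
  split_ifs
  · rw [Finset.smul_sum]
  · simp

theorem Bop_prod (X : G.V × H.V → G.B × H.B → Mat d) (p : G.U × H.U) (a : G.A × H.A) :
    (G.prod H).Bop X p a =
      G.Bop (fun v b => H.Bop (fun v' b' => X (v, v') (b, b')) p.2 a.2) p.1 a.1 := by
  have h : (G.prod H).Bop X p a = ∑ q : G.V × H.V, ∑ b : G.B × H.B,
      if G.proj p.1 q.1 b.1 = some a.1 ∧ H.proj p.2 q.2 b.2 = some a.2 then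
        ((G.μc p.1 q.1 * H.μc p.2 q.2 : ℝ) : ℂ) • X q b else 0 := by
    refine Finset.sum_congr rfl fun q _ => Finset.sum_congr rfl fun b _ => ?_
    exact if_congr (proj_prod_eq_some_iff G H p q b a) 
      (congrArg (fun r : ℝ => (r : ℂ) • X q b) (μc_prod G H p q)) rfl
  rw [h]
  simp only [Bop, Fintype.sum_prod_type]
  refine Finset.sum_congr rfl fun v _ => ?_
  rw [Finset.sum_comm]
  refine Finset.sum_congr rfl fun b _ => ?_
  split_ifs with hb
  · simp only [hb, true_and, Finset.smul_sum, smul_ite, smul_zero, smul_smul, Complex.ofReal_mul]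
  · simp [hb]

theorem vecMat_eq {n : ℕ} (w : Fin n → ℝ) (A : Fin n → G.V → G.B → Mat d) :
    G.vecMat w A = ∑ i, (w i : ℂ) • G.sqMat (A i) := by
  unfold vecMat sqMat
  refine Finset.sum_congr rfl fun i _ => ?_
  congr 1
  refine Finset.sum_congr rfl fun u _ => ?_
  congr 1
  refine Finset.sum_congr rfl fun a _ => ?_
  ext ⟨j, k⟩ ⟨l, m⟩
  simp only [Bop, mconj, Matrix.sum_apply, Matrix.smul_apply, kroneckerMap_apply, Matrix.map_apply,
    map_sum, smul_eq_mul]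
  rw [Finset.sum_mul_sum]
  refine Finset.sum_congr rfl fun v _ => Finset.sum_congr rfl fun v' _ => ?_
  rw [Finset.sum_mul_sum, Finset.mul_sum]
  refine Finset.sum_congr rfl fun b _ => ?_
  rw [Finset.mul_sum]
  refine Finset.sum_congr rfl fun b' _ => ?_
  by_cases h1 : G.proj u v b = some a <;> by_cases h2 : G.proj u v' b' = some a <;>
    simp [h1, h2]
  ring

theorem sqMat_prod (X : G.V × H.V → G.B × H.B → Mat d) :
    (G.prod H).sqMat X = ∑ p : H.U × H.A, (H.μL p.1 : ℂ) •
      G.sqMat (fun v b => H.Bop (fun v' b' => X (v, v') (b, b')) p.1 p.2) := by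
  have h : (G.prod H).sqMat X = ∑ p : G.U × H.U, ((G.prod H).μL p : ℂ) • ∑ a : G.A × H.A,
      mconj ((G.prod H).Bop X p a) ⊗ₖ (G.prod H).Bop X p a := rfl
  rw [h]
  simp only [Bop_prod, μL_prod, sqMat, Fintype.sum_prod_type, Finset.smul_sum, smul_smul,
    Complex.ofReal_mul]
  rw [Finset.sum_comm]
  refine Finset.sum_congr rfl fun u' _ => ?_
  conv_rhs => rw [Finset.sum_comm]
  refine Finset.sum_congr rfl fun u _ => ?_
  rw [Finset.sum_comm]
  simp only [mul_comm]

theorem opNorm_vecMat_le {n : ℕ} {w : Fin n → ℝ} (hw : ∀ i, 0 ≤ w i)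
    {A : Fin n → G.V → G.B → Mat d} (hA : ∀ i v b, (A i v b).PosSemidef) {c : ℝ} (hc : 0 ≤ c)
    (h : ∀ v, opNorm (G.vecMatAt w A v) ≤ c) :
    opNorm (G.vecMat w A) ≤
      Fintype.card G.A * (8 * (Fintype.card G.V * (Fintype.card G.V * c))) := by
  have hV : ∀ i v, (∑ b, A i v b).PosSemidef := fun i v => posSemidef_sum _ fun b _ => hA i v b
  have h1 := opNorm_sum_mconj_kronecker_sum_le hw hV hc h
  refine le_trans ?_ (mul_le_mul_of_nonneg_left h1 (Nat.cast_nonneg _))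
  rw [← opNorm_smul (Nat.cast_nonneg _), vecMat_eq, Finset.smul_sum]
  refine opNorm_le_of_sub_posSemidef (posSemidef_sum _ fun i _ =>
    (sqMat_posSemidef (hA i)).smul (Complex.zero_le_real.2 (hw i))) ?_
  rw [← Finset.sum_sub_distrib]
  refine posSemidef_sum _ fun i _ => ?_
  rw [smul_comm, ← smul_sub]
  exact (card_smul_sub_sqMat_posSemidef (hA i)).smul (Complex.zero_le_real.2 (hw i))

/-- The set of values whose supremum is `val₊*(G)`. -/
def valPlusSet (G : ProjGame) : Set ℝ :=
  { x | ∃ (n d : ℕ) (w : Fin n → ℝ) (A : Fin n → G.V → G.B → Mat d),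
    (∀ i, 0 < w i) ∧ G.IsVecStrategy A ∧
    (∀ v, Real.sqrt (opNorm (G.vecMatAt w A v)) ≤ 1) ∧
    x = opNorm (G.vecMat w A) }

theorem valPlus_eq_sSup (G : ProjGame) : G.valPlus = sSup G.valPlusSet := rfl

theorem valPlusSet_nonneg {x : ℝ} (hx : x ∈ G.valPlusSet) : 0 ≤ x := by
  obtain ⟨n, d, w, A, -, -, -, rfl⟩ := hx
  exact opNorm_nonneg _

theorem valPlusSet_nonempty (G : ProjGame) : G.valPlusSet.Nonempty :=
  ⟨_, 0, 0, 0, 0, fun i => i.elim0, fun i => i.elim0, fun v => by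
    simp [vecMatAt, opNorm], rfl⟩

theorem bddAbove_valPlusSet (G : ProjGame) : BddAbove G.valPlusSet := by
  refine ⟨Fintype.card G.A * (8 * (Fintype.card G.V * (Fintype.card G.V * 1))), ?_⟩
  rintro x ⟨n, d, w, A, hw, hA, hn, rfl⟩
  exact opNorm_vecMat_le (fun i => (hw i).le) (fun i v => (hA i v).1) zero_le_one
    fun v => (Real.sqrt_le_one_iff_le_one).1 (hn v)

theorem valPlus_nonneg (G : ProjGame) : 0 ≤ G.valPlus :=
  Real.sSup_nonneg fun _ hx => valPlusSet_nonneg hx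

/-- Strategies indexed by an arbitrary finite type with nonnegative weights and squared norm at
most `c` have value at most `c · val₊*(G)`. -/
theorem opNorm_sum_sqMat_le {Ω : Type*} [Fintype Ω] {w : Ω → ℝ} (hw : ∀ i, 0 ≤ w i)
    {A : Ω → G.V → G.B → Mat d} (hA : ∀ i v b, (A i v b).PosSemidef)
    (hA' : ∀ i v, (1 - ∑ b, A i v b).PosSemidef) {c : ℝ} (hc : 0 ≤ c)
    (h : ∀ v, opNorm (∑ i, (w i : ℂ) • (mconj (∑ b, A i v b) ⊗ₖ ∑ b, A i v b)) ≤ c) :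
    opNorm (∑ i, (w i : ℂ) • G.sqMat (A i)) ≤ c * G.valPlus := by
  classical
  have hpos : ∀ r, 0 < r → c ≤ r → opNorm (∑ i, (w i : ℂ) • G.sqMat (A i)) ≤ r * G.valPlus := by
    intro r hr hcr
    let e := (Fintype.equivFin Ω).symm
    let w' : Ω → ℝ := fun i => if w i = 0 then 1 else r⁻¹ * w i
    let A' : Ω → G.V → G.B → Mat d := fun i => if w i = 0 then 0 else A i
    have key : ∀ {κ : Type} (F : (G.V → G.B → Mat d) → Matrix κ κ ℂ),
        F 0 = 0 → ∑ i, (w' (e i) : ℂ) • F (A' (e i)) =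
          ((r⁻¹ : ℝ) : ℂ) • ∑ i, (w i : ℂ) • F (A i) := by
      intro κ F hF
      rw [Equiv.sum_comp e fun i => (w' i : ℂ) • F (A' i), Finset.smul_sum]
      refine Finset.sum_congr rfl fun i _ => ?_
      by_cases hi : w i = 0
      · simp [w', A', hi, hF]
      · simp only [w', A', hi, if_false, Complex.ofReal_mul, mul_smul]
    have hr' : 0 ≤ r⁻¹ := inv_nonneg.2 hr.le
    have hmem : r⁻¹ * opNorm (∑ i, (w i : ℂ) • G.sqMat (A i)) ∈ G.valPlusSet := by
      refine ⟨_, d, fun i => w' (e i), fun i => A' (e i), fun i => ?_, fun i v => ?_,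
        fun v => ?_, ?_⟩
      · by_cases hi : w (e i) = 0
        · simp [w', hi]
        · simpa [w', hi, hr] using lt_of_le_of_ne (hw _) (Ne.symm hi)
      · by_cases hi : w (e i) = 0
        · simpa [A', hi] using ⟨fun _ => PosSemidef.zero, PosSemidef.one⟩
        · simpa [A', hi] using ⟨hA _ v, hA' _ v⟩
      · rw [Real.sqrt_le_one_iff_le_one, vecMatAt,
          key (fun X => mconj (∑ b, X v b) ⊗ₖ ∑ b, X v b) (by simp), opNorm_smul hr']
        calc r⁻¹ * _ ≤ r⁻¹ * r := mul_le_mul_of_nonneg_left ((h v).trans hcr) hr'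
          _ = 1 := inv_mul_cancel₀ hr.ne'
      · rw [vecMat_eq, key G.sqMat (by simp [sqMat, Bop]), opNorm_smul hr']
    have := le_csSup (bddAbove_valPlusSet G) hmem
    rwa [← valPlus_eq_sSup, inv_mul_le_iff₀ hr] at this
  refine le_of_forall_pos_le_add fun δ hδ => ?_
  have hg : 0 < G.valPlus + 1 := by linarith [G.valPlus_nonneg]
  have hδ' : 0 < δ / (G.valPlus + 1) := div_pos hδ hg
  refine (hpos (c + δ / (G.valPlus + 1)) (by linarith) (by linarith)).trans ?_
  rw [add_mul]
  refine add_le_add_right ?_ _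
  rw [div_mul_eq_mul_div, div_le_iff₀ hg]
  nlinarith

theorem sqMat_prod_kronReindex {e : ℕ} (f : Fin e ≃ Fin d × Fin d') (A : G.V → G.B → Mat d)
    (B : H.V → H.B → Mat d') :
    (G.prod H).sqMat (fun v b => kronReindex f (A v.1 b.1) (B v.2 b.2)) =
      kronReindex ((f.prodCongr f).trans (Equiv.prodProdProdComm _ _ _ _))
        (G.sqMat A) (H.sqMat B) := by
  have hB : ∀ (p : G.U × H.U) (a : G.A × H.A),
      (G.prod H).Bop (fun v b => kronReindex f (A v.1 b.1) (B v.2 b.2)) p a =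
        kronReindex f (G.Bop A p.1 a.1) (H.Bop B p.2 a.2) := by
    intro p a
    refine (Bop_prod (fun v b => kronReindex f (A v.1 b.1) (B v.2 b.2)) p a).trans ?_
    simp only [Bop_map]
    exact Bop_map ((kronReindex f).flip (H.Bop B p.2 a.2)) A p.1 a.1
  have h : ∀ X : G.V × H.V → G.B × H.B → Mat e,
      (G.prod H).sqMat X = ∑ p : G.U × H.U, ((G.prod H).μL p : ℂ) • ∑ a : G.A × H.A,
        mconj ((G.prod H).Bop X p a) ⊗ₖ (G.prod H).Bop X p a := fun _ => rfl
  refine (h fun v b => kronReindex f (A v.1 b.1) (B v.2 b.2)).trans ?_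
  rw [sqMat, sqMat, kronReindex_sum_sum]
  refine Finset.sum_congr rfl fun p _ => ?_
  rw [kronReindex_smul_smul, μL_prod, kronReindex_sum_sum]
  congr 1
  refine Finset.sum_congr rfl fun a _ => ?_
  exact (congrArg (fun Z : Mat e => mconj Z ⊗ₖ Z) (hB p a)).trans
    (mconj_kronReindex_kronecker f _ _)

theorem valPlus_mul_le (G H : ProjGame) : G.valPlus * H.valPlus ≤ (G.prod H).valPlus := by
  rw [mul_comm]
  refine mul_sSup_le H.valPlus_nonneg G.valPlusSet_nonempty (valPlus_nonneg _) fun x hx => ?_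
  rw [mul_comm]
  refine mul_sSup_le (valPlusSet_nonneg hx) H.valPlusSet_nonempty (valPlus_nonneg _) fun y hy => ?_
  obtain ⟨n, d, w, A, hw, hA, hn, rfl⟩ := hx
  obtain ⟨n', d', w', B, hw', hB, hn', rfl⟩ := hy
  let f : Fin (d * d') ≃ Fin d × Fin d' := finProdFinEquiv.symm
  have hsum : ∀ (i : Fin n × Fin n') (v : G.V × H.V),
      ∑ b : G.B × H.B, kronReindex f (A i.1 v.1 b.1) (B i.2 v.2 b.2) =
        kronReindex f (∑ b, A i.1 v.1 b) (∑ b, B i.2 v.2 b) := fun i v =>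
    (kronReindex_sum_sum f _ _).symm
  have hApsd : ∀ i v, (∑ b, A i v b).PosSemidef := fun i v =>
    posSemidef_sum _ fun b _ => (hA i v).1 b
  have hBpsd : ∀ i v, (∑ b, B i v b).PosSemidef := fun i v =>
    posSemidef_sum _ fun b _ => (hB i v).1 b
  have key := opNorm_sum_sqMat_le (G := G.prod H) (Ω := Fin n × Fin n')
    (w := fun i => w i.1 * w' i.2)
    (A := fun i v b => kronReindex f (A i.1 v.1 b.1) (B i.2 v.2 b.2))
    (fun i => mul_nonneg (hw _).le (hw' _).le)
    (fun i v b => kronReindex_posSemidef f ((hA i.1 v.1).1 b.1) ((hB i.2 v.2).1 b.2))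
    (fun i v => by
      have := one_sub_kronReindex_posSemidef f (hApsd i.1 v.1) (hA i.1 v.1).2 (hB i.2 v.2).2
      rwa [← hsum i v] at this)
    zero_le_one
    (fun v => by
      have hv : ∀ i : Fin n × Fin n',
          mconj (∑ b : G.B × H.B, kronReindex f (A i.1 v.1 b.1) (B i.2 v.2 b.2)) ⊗ₖ
            ∑ b : G.B × H.B, kronReindex f (A i.1 v.1 b.1) (B i.2 v.2 b.2) =
          kronReindex ((f.prodCongr f).trans (Equiv.prodProdProdComm _ _ _ _))
            (mconj (∑ b, A i.1 v.1 b) ⊗ₖ ∑ b, A i.1 v.1 b)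
            (mconj (∑ b, B i.2 v.2 b) ⊗ₖ ∑ b, B i.2 v.2 b) := fun i => by
        rw [hsum i v, mconj_kronReindex_kronecker]
      change opNorm (∑ i : Fin n × Fin n', ((w i.1 * w' i.2 : ℝ) : ℂ) •
        (mconj (∑ b : G.B × H.B, kronReindex f (A i.1 v.1 b.1) (B i.2 v.2 b.2)) ⊗ₖ
            ∑ b : G.B × H.B, kronReindex f (A i.1 v.1 b.1) (B i.2 v.2 b.2))) ≤ 1
      simp only [hv, ← kronReindex_smul_smul]
      rw [← kronReindex_sum_sum _
        (fun i => (w i : ℂ) • (mconj (∑ b, A i v.1 b) ⊗ₖ ∑ b, A i v.1 b))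
        (fun i => (w' i : ℂ) • (mconj (∑ b, B i v.2 b) ⊗ₖ ∑ b, B i v.2 b)), opNorm_kronReindex]
      · exact mul_le_one₀ (Real.sqrt_le_one_iff_le_one.1 (hn v.1)) (opNorm_nonneg _)
          (Real.sqrt_le_one_iff_le_one.1 (hn' v.2))
      · exact posSemidef_sum _ fun i _ => ((mconj_posSemidef (hApsd i v.1)).kronecker
          (hApsd i v.1)).smul (Complex.zero_le_real.2 (hw i).le)
      · exact posSemidef_sum _ fun i _ => ((mconj_posSemidef (hBpsd i v.2)).kronecker
          (hBpsd i v.2)).smul (Complex.zero_le_real.2 (hw' i).le))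
  rw [one_mul] at key
  refine le_trans (le_of_eq ?_) key
  simp only [sqMat_prod_kronReindex, ← kronReindex_smul_smul]
  rw [← kronReindex_sum_sum _ (fun i => (w i : ℂ) • G.sqMat (A i))
    (fun i => (w' i : ℂ) • H.sqMat (B i)), opNorm_kronReindex, vecMat_eq, vecMat_eq]
  · exact posSemidef_sum _ fun i _ =>
      (sqMat_posSemidef fun v => (hA i v).1).smul (Complex.zero_le_real.2 (hw i).le)
  · exact posSemidef_sum _ fun i _ =>
      (sqMat_posSemidef fun v => (hB i v).1).smul (Complex.zero_le_real.2 (hw' i).le)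

theorem valPlus_prod_le (G H : ProjGame) : (G.prod H).valPlus ≤ H.valPlus * G.valPlus := by
  refine csSup_le (G.prod H).valPlusSet_nonempty ?_
  rintro x ⟨n, d, w, A, hw, hA, hn, rfl⟩
  change Fin n → G.V × H.V → G.B × H.B → Mat d at A
  have hpsd : ∀ (i : Fin n) (v : G.V × H.V) (b : G.B × H.B), (A i v b).PosSemidef :=
    fun i v => (hA i v).1
  have hsum : ∀ (i : Fin n) (v : G.V) (v' : H.V),
      ∑ b', ∑ b, A i (v, v') (b, b') = ∑ b : G.B × H.B, A i (v, v') b := fun i v v' => by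
    rw [Fintype.sum_prod_type, Finset.sum_comm]
  have hone : ∀ (i : Fin n) (v : G.V) (v' : H.V),
      (1 - ∑ b', ∑ b, A i (v, v') (b, b')).PosSemidef := fun i v v' => by
    rw [hsum]
    exact (hA i (v, v')).2
  have hpsd' : ∀ (i : Fin n) (v : G.V) (v' : H.V) (b' : H.B),
      (∑ b, A i (v, v') (b, b')).PosSemidef := fun i v v' b' =>
    posSemidef_sum _ fun b _ => hpsd i _ _
  have hH : ∀ v : G.V, opNorm (∑ i, (w i : ℂ) •
      H.sqMat (fun v' b' => ∑ b, A i (v, v') (b, b'))) ≤ 1 * H.valPlus := fun v =>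
    opNorm_sum_sqMat_le (fun i => (hw i).le) (fun i => hpsd' i v) (fun i => hone i v)
      zero_le_one fun v' => by
        simp only [hsum]
        exact Real.sqrt_le_one_iff_le_one.1 (hn (v, v'))
  have key := opNorm_sum_sqMat_le (G := G) (Ω := Fin n × H.U × H.A)
    (w := fun q => w q.1 * H.μL q.2.1)
    (A := fun q v b => H.Bop (fun v' b' => A q.1 (v, v') (b, b')) q.2.1 q.2.2)
    (fun q => mul_nonneg (hw _).le (H.μL_nonneg _))
    (fun q v b => Bop_posSemidef (fun v' b' => hpsd _ _ _) _ _)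
    (fun q v => by
      rw [sum_Bop]
      exact one_sub_Bop_posSemidef (hpsd' q.1 v) (hone q.1 v) _ _)
    H.valPlus_nonneg
    (fun v => by
      refine le_trans (le_of_eq ?_) ((hH v).trans_eq (one_mul _))
      simp only [sum_Bop, sqMat, Fintype.sum_prod_type, Finset.smul_sum, smul_smul,
        Complex.ofReal_mul])
  refine le_trans (le_of_eq ?_) key
  refine (congrArg opNorm (vecMat_eq (G := G.prod H) w A)).trans ?_
  congr 1
  rw [Fintype.sum_prod_type]
  refine Finset.sum_congr rfl fun i _ => ?_
  rw [sqMat_prod (A i), Finset.smul_sum]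
  simp only [smul_smul, Complex.ofReal_mul]

end ProjGame

/-- The relaxed value is perfectly multiplicative: `val₊*(G⊗H) = val₊*(G)·val₊*(H)`. -/
theorem valPlus_mul (G H : ProjGame) :
    (G.prod H).valPlus = G.valPlus * H.valPlus := by
  exact le_antisymm ((ProjGame.valPlus_prod_le G H).trans_eq (mul_comm _ _))
    (ProjGame.valPlus_mul_le G H)
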